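/- arXiv:1812.04508 — 2 statements merged into one kernel-verified Lean document; each statement's English description precedes it below -/
import Mathlib

section
/- Let G be a fan loop. Then for every a, a₁, a₂, a₃ in G and z₁, z₂, z₃ in the center Z(G): (1) t(z₁a₁, z₂a₂, z₃a₃) = t(a₁, a₂, a₃); (2) p(z₁a₁, z₂a₂, z₃a₃) = p(a₁, a₂, a₃); (3) t(a, a\e, a)·a = a·p(a, a\e, a); (4) t(a, e/a, a)·a = a·p(a, e/a, a); (5) p(a, a\e, a)·t(e/a, a, a\e) = e. -/
/-- The nucleus of a magma: elements associating with all pairs in all three positions. -/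
def nucleus (G : Type*) [Mul G] : Set G :=
  {a | (∀ b c : G, (a * b) * c = a * (b * c)) ∧ (∀ b c : G, (b * a) * c = b * (a * c)) ∧
       (∀ b c : G, (b * c) * a = b * (c * a))}

/-- The center of a magma: commuting elements of the nucleus. -/
def centrum (G : Type*) [Mul G] : Set G :=
  {a | ∀ b : G, a * b = b * a} ∩ nucleus G

/-- A (nonassociative) fan loop. -/
class FanLoop (G : Type*) extends Mul G, One G where
  /-- left division: `ldiv a b` is the unique `x` with `a * x = b`. -/
  ldiv : G → G → G
  /-- right division: `rdiv b a` is the unique `y` with `y * a = b`. -/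
  rdiv : G → G → G
  one_mul : ∀ a : G, 1 * a = a
  mul_one : ∀ a : G, a * 1 = a
  mul_ldiv : ∀ a b : G, a * ldiv a b = b
  ldiv_unique : ∀ a x b : G, a * x = b → x = ldiv a b
  rdiv_mul : ∀ a b : G, rdiv b a * a = b
  rdiv_unique : ∀ a y b : G, y * a = b → y = rdiv b a
  t : G → G → G → G
  p : G → G → G → G
  t_mem : ∀ a b c : G, t a b c ∈ nucleus G
  p_mem : ∀ a b c : G, p a b c ∈ nucleus G
  t_spec : ∀ a b c : G, (a * b) * c = t a b c * (a * (b * c))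
  p_spec : ∀ a b c : G, (a * b) * c = (a * (b * c)) * p a b c

namespace FanLoop
variable {G : Type*} [FanLoop G]
/-- the inverse `x⁻¹ = x \ e` of an element (used for elements of the nucleus,
where it is the two-sided group inverse). -/
def linv (x : G) : G := ldiv x 1
end FanLoop

open FanLoop

theorem fl_lc {G : Type*} [FanLoop G] {a x y : G} (h : a * x = a * y) : x = y :=
  (ldiv_unique a x _ h).trans (ldiv_unique a y _ rfl).symm

theorem fl_rc {G : Type*} [FanLoop G] {a x y : G} (h : x * a = y * a) : x = y :=
  (rdiv_unique a x _ h).trans (rdiv_unique a y _ rfl).symm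

theorem fl_c1 {G : Type*} [FanLoop G] {z : G} (h : z ∈ centrum G) (x y : G) :
    (z * x) * y = z * (x * y) := h.2.1 x y

theorem fl_c2 {G : Type*} [FanLoop G] {z : G} (h : z ∈ centrum G) (x y : G) :
    x * (z * y) = z * (x * y) := by
  rw [← h.2.2.1 x y, ← h.1 x, h.2.1]

/-- Lemma 2.3 (center identities) of Ludkowski,
"Left invariant measures on locally compact fan loops". -/
theorem fanLoop_center_identities {G : Type*} [FanLoop G] (a a₁ a₂ a₃ z₁ z₂ z₃ : G)
    (h₁ : z₁ ∈ centrum G) (h₂ : z₂ ∈ centrum G) (h₃ : z₃ ∈ centrum G) :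
    t (z₁ * a₁) (z₂ * a₂) (z₃ * a₃) = t a₁ a₂ a₃ ∧
    p (z₁ * a₁) (z₂ * a₂) (z₃ * a₃) = p a₁ a₂ a₃ ∧
    t a (ldiv a 1) a * a = a * p a (ldiv a 1) a ∧
    t a (rdiv 1 a) a * a = a * p a (rdiv 1 a) a ∧
    p a (ldiv a 1) a * t (rdiv 1 a) a (ldiv a 1) = 1 := by
  have e : ((z₁ * a₁) * (z₂ * a₂)) * (z₃ * a₃) = z₃ * (z₁ * (z₂ * ((a₁ * a₂) * a₃))) := by
    rw [fl_c2 h₃, fl_c1 h₁, fl_c2 h₂, fl_c1 h₁, fl_c1 h₂]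
  have e' : (z₁ * a₁) * ((z₂ * a₂) * (z₃ * a₃)) = z₃ * (z₁ * (z₂ * (a₁ * (a₂ * a₃)))) := by
    rw [fl_c2 h₃, fl_c2 h₃, fl_c1 h₁, fl_c1 h₂, fl_c2 h₂]
  refine ⟨?_, ?_, ?_, ?_, ?_⟩
  · have h := t_spec (z₁ * a₁) (z₂ * a₂) (z₃ * a₃)
    rw [e, e', fl_c2 h₃ (t _ _ _), fl_c2 h₁ (t _ _ _), fl_c2 h₂ (t _ _ _), t_spec a₁ a₂ a₃] at h
    exact (fl_rc (fl_lc (fl_lc (fl_lc h)))).symm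
  · have h := p_spec (z₁ * a₁) (z₂ * a₂) (z₃ * a₃)
    rw [e, e', fl_c1 h₃, fl_c1 h₁, fl_c1 h₂, p_spec a₁ a₂ a₃] at h
    exact (fl_lc (fl_lc (fl_lc (fl_lc h)))).symm
  · have h := t_spec a (ldiv a 1) a
    have h' := p_spec a (ldiv a 1) a
    rw [mul_ldiv, FanLoop.one_mul] at h h'
    calc t a (ldiv a 1) a * a
        = t a (ldiv a 1) a * ((a * (ldiv a 1 * a)) * p a (ldiv a 1) a) := by rw [← h']
      _ = a * p a (ldiv a 1) a := by rw [← (t_mem a (ldiv a 1) a).1, ← h]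
  · have h := t_spec a (rdiv 1 a) a
    have h' := p_spec a (rdiv 1 a) a
    rw [rdiv_mul, FanLoop.mul_one] at h h'
    exact h.symm.trans h'
  · have h := t_spec (rdiv 1 a) a (ldiv a 1)
    have h' := p_spec a (ldiv a 1) a
    rw [rdiv_mul, mul_ldiv, FanLoop.one_mul, FanLoop.mul_one] at h
    rw [mul_ldiv, FanLoop.one_mul] at h'
    have ht := t_mem (rdiv 1 a) a (ldiv a 1)
    have hp := p_mem a (ldiv a 1) a
    have hb : ldiv a 1 * a = t (rdiv 1 a) a (ldiv a 1) := by
      have h2 : ldiv a 1 * a = (t (rdiv 1 a) a (ldiv a 1) * rdiv 1 a) * a :=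
        congrArg (· * a) h
      rw [ht.1, rdiv_mul, FanLoop.mul_one] at h2
      exact h2
    rw [hb, hp.2.2] at h'
    have h3 : t (rdiv 1 a) a (ldiv a 1) * p a (ldiv a 1) a = 1 :=
      fl_lc (h'.symm.trans (FanLoop.mul_one a).symm)
    apply fl_rc (a := p a (ldiv a 1) a)
    rw [hp.1, h3, FanLoop.one_mul, FanLoop.mul_one]
end

section
/- Let G be a T1 topological locally compact fan loop satisfying Condition (3.5.2) with compact subgroup N₀, let φ, f, f₁ be not identically zero functions in C₀₀⁺(G), and let f₀ ∈ Υ(G,N₀). Then (f₀ : f)⁻¹ ≤ J_{φ,f₀}(f) ≤ (f : f₀) and (f₁ : f₀)⁻¹·(f₀ : f)⁻¹ ≤ J_{φ,f₁}(f) ≤ (f : f₀)·(f₀ : f₁), where J_{φ,h}(f) = (f : φ)/(h : φ). -/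
open FanLoop

/-- The covering ratio `(f : φ)` of Haar-functional theory on a fan loop. -/
noncomputable def covRatio {G : Type*} [FanLoop G] (f φ : G → ℝ) : ℝ :=
  sInf {r : ℝ | ∃ (m : ℕ) (b : Fin m → G) (c : Fin m → ℝ),
    (∀ j, 0 < c j) ∧ (∀ x : G, f x ≤ ∑ j, c j * φ (b j * x)) ∧ r = ∑ j, c j}


section CovAux
open MeasureTheory

variable {G : Type*} [FanLoop G]

theorem fl_lcancel {a x y : G} (h : a * x = a * y) : x = y := by
  rw [ldiv_unique a x _ h, ← ldiv_unique a y _ rfl]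

theorem fl_rcancel {a x y : G} (h : x * a = y * a) : x = y := by
  rw [rdiv_unique a x _ h, ← rdiv_unique a y _ rfl]

theorem fl_inv_mul {x : G} (hx : x ∈ nucleus G) : ldiv x 1 * x = 1 := by
  apply fl_lcancel (a := x)
  rw [← hx.1, mul_ldiv, FanLoop.one_mul, FanLoop.mul_one]

theorem fl_inv_mul_cancel {x : G} (hx : x ∈ nucleus G) (hx' : ldiv x 1 ∈ nucleus G) (y : G) :
    ldiv x 1 * (x * y) = y := by
  rw [← hx'.1, fl_inv_mul hx, FanLoop.one_mul]

/-- The normal core of `N₀`. -/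
def flCore (N₀ : Set G) : Set G := {n | n ∈ N₀ ∧ ∀ a : G, ∃ n' ∈ N₀, a * n = n' * a}

theorem fl_t_mem (N₀ : Set G) (hsub : N₀ ⊆ nucleus G)
    (hmulc : ∀ x ∈ N₀, ∀ y ∈ N₀, x * y ∈ N₀) (hinvc : ∀ x ∈ N₀, ldiv x 1 ∈ N₀)
    (ht : ∀ a b c : G, t a b c ∈ N₀) (b c d : G) : t b c d ∈ flCore N₀ := by
  refine ⟨ht _ _ _, fun a => ?_⟩
  have e1 : ((a * b) * c) * d = t (a*b) c d * (t a b (c*d) * (a * (b * (c * d)))) := by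
    rw [t_spec (a*b) c d, t_spec a b (c*d)]
  have e2 : ((a * b) * c) * d =
      t a b c * (t a (b*c) d * (a * (t b c d * (b * (c * d))))) := by
    rw [t_spec a b c, (hsub (ht a b c)).1, t_spec a (b*c) d, t_spec b c d]
  have m1 := hinvc _ (ht a b c)
  have m2 := hinvc _ (ht a (b*c) d)
  have e3 : a * (t b c d * (b * (c * d))) =
      ldiv (t a (b*c) d) 1 * (ldiv (t a b c) 1 * (t (a*b) c d * (t a b (c*d) * (a * (b * (c * d)))))) := by
    rw [← e1, e2, fl_inv_mul_cancel (hsub (ht _ _ _)) (hsub m1),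
      fl_inv_mul_cancel (hsub (ht _ _ _)) (hsub m2)]
  refine ⟨ldiv (t a (b*c) d) 1 * (ldiv (t a b c) 1 * (t (a*b) c d * t a b (c*d))), ?_, ?_⟩
  · exact hmulc _ m2 _ (hmulc _ m1 _ (hmulc _ (ht _ _ _) _ (ht _ _ _)))
  · apply fl_rcancel (a := b * (c * d))
    rw [(hsub (ht b c d)).2.1, e3]
    simp only [(hsub m1).1, (hsub m2).1, (hsub (ht (a*b) c d)).1, (hsub (ht a b (c*d))).1]

theorem fl_core_conj (N₀ : Set G) (hsub : N₀ ⊆ nucleus G) {n : G} (hn : n ∈ flCore N₀) (b : G) :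
    ∃ n' ∈ flCore N₀, b * n = n' * b := by
  obtain ⟨n', hn', e⟩ := hn.2 b
  refine ⟨n', ⟨hn', fun a => ?_⟩, e⟩
  obtain ⟨m, hm, e2⟩ := hn.2 (a * b)
  refine ⟨m, hm, ?_⟩
  apply fl_rcancel (a := b)
  rw [(hsub hn').2.1, ← e, ← (hsub hn.1).2.2, e2, (hsub hm).1]

theorem fl_core_mul (N₀ : Set G) (hsub : N₀ ⊆ nucleus G)
    (hmulc : ∀ x ∈ N₀, ∀ y ∈ N₀, x * y ∈ N₀) {x y : G} (hx : x ∈ flCore N₀)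
    (hy : y ∈ flCore N₀) : x * y ∈ flCore N₀ := by
  refine ⟨hmulc _ hx.1 _ hy.1, fun a => ?_⟩
  obtain ⟨x', hx', ex⟩ := hx.2 a
  obtain ⟨y', hy', ey⟩ := hy.2 a
  refine ⟨x' * y', hmulc _ hx' _ hy', ?_⟩
  rw [← (hsub hx.1).2.1, ex, (hsub hx').1, ey, (hsub hx').1]

theorem fl_core_inv (N₀ : Set G) (hsub : N₀ ⊆ nucleus G)
    (hinvc : ∀ x ∈ N₀, ldiv x 1 ∈ N₀) {x : G} (hx : x ∈ flCore N₀) :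
    ldiv x 1 ∈ flCore N₀ := by
  refine ⟨hinvc _ hx.1, fun a => ?_⟩
  obtain ⟨x', hx', ex⟩ := hx.2 a
  refine ⟨ldiv x' 1, hinvc _ hx', ?_⟩
  apply fl_lcancel (a := x')
  rw [← (hsub hx').1, ← (hsub hx').1, ← ex, mul_ldiv, (hsub hx.1).2.1, mul_ldiv,
    FanLoop.one_mul, FanLoop.mul_one]

theorem fl_core_one (N₀ : Set G) (h1 : (1 : G) ∈ N₀) : (1 : G) ∈ flCore N₀ :=
  ⟨h1, fun a => ⟨1, h1, by rw [FanLoop.one_mul, FanLoop.mul_one]⟩⟩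

theorem haar_mean (K : Type*) [Group K] [TopologicalSpace K] [IsTopologicalGroup K]
    [CompactSpace K] [MeasurableSpace K] [BorelSpace K] :
    ∃ μ : Measure K, IsProbabilityMeasure μ ∧
      (∀ C : K →* K, Continuous C → Function.Surjective C → ∀ ψ : K → ℝ, Continuous ψ →
        ∫ k, ψ (C k) ∂μ = ∫ k, ψ k ∂μ) ∧
      (∀ s : K, ∀ ψ : K → ℝ, Continuous ψ → ∫ k, ψ (k * s) ∂μ = ∫ k, ψ k ∂μ) := by
  let μ : Measure K := Measure.haarMeasure ⊤
  have hp : IsProbabilityMeasure μ := ⟨by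
    have := Measure.haarMeasure_self (K₀ := (⊤ : TopologicalSpace.PositiveCompacts K))
    simpa using this⟩
  have asm : ∀ (ψ : K → ℝ), Continuous ψ → ∀ ν : Measure K, AEStronglyMeasurable ψ ν :=
    fun ψ h ν => h.aestronglyMeasurable
  refine ⟨μ, hp, ?_, ?_⟩
  · intro C hC hs ψ hψ
    have : Measure.IsHaarMeasure (Measure.map C μ) :=
      Measure.isHaarMeasure_map_of_isFiniteMeasure μ C hC hs
    have : IsProbabilityMeasure (Measure.map C μ) :=
      Measure.isProbabilityMeasure_map hC.measurable.aemeasurable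
    have e := Measure.isHaarMeasure_eq_of_isProbabilityMeasure (Measure.map C μ) μ
    rw [← integral_map hC.measurable.aemeasurable (asm ψ hψ _), e]
  · intro s ψ hψ
    have hc : Continuous (fun k : K => k * s) := by fun_prop
    have : Measure.IsHaarMeasure (Measure.map (fun k : K => k * s) μ) :=
      Measure.isHaarMeasure_map_smul μ (MulOpposite.op s)
    have : IsProbabilityMeasure (Measure.map (fun k : K => k * s) μ) :=
      Measure.isProbabilityMeasure_map hc.measurable.aemeasurable
    have e := Measure.isHaarMeasure_eq_of_isProbabilityMeasure (Measure.map (fun k : K => k * s) μ) μ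
    rw [← integral_map (φ := fun k : K => k * s) hc.measurable.aemeasurable (asm ψ hψ _), e]

theorem fl_t2 [TopologicalSpace G] [T1Space G]
    (hl : Continuous fun q : G × G => ldiv q.1 q.2) : T2Space G := by
  rw [t2_iff_isClosed_diagonal]
  have : Set.diagonal G = (fun q : G × G => ldiv q.1 q.2) ⁻¹' {1} := by
    ext ⟨a, b⟩
    simp only [Set.mem_diagonal_iff, Set.mem_preimage, Set.mem_singleton_iff]
    constructor
    · rintro rfl; exact (ldiv_unique _ _ _ (FanLoop.mul_one a)).symm
    · intro h
      have := mul_ldiv a b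
      rw [h, FanLoop.mul_one] at this
      exact this
  rw [this]
  exact isClosed_singleton.preimage hl

theorem fl_mean {G : Type*} [TopologicalSpace G] [T1Space G] [FanLoop G]
    (hm : Continuous fun q : G × G => q.1 * q.2)
    (hl : Continuous fun q : G × G => ldiv q.1 q.2)
    (hr : Continuous fun q : G × G => rdiv q.1 q.2)
    (N₀ : Set G) (hcpt : IsCompact N₀) (hsub : N₀ ⊆ nucleus G) (h1 : (1 : G) ∈ N₀)
    (hmulc : ∀ x ∈ N₀, ∀ y ∈ N₀, x * y ∈ N₀) (hinvc : ∀ x ∈ N₀, ldiv x 1 ∈ N₀)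
    (ht : ∀ a b c : G, t a b c ∈ N₀) :
    ∃ (K : Set G) (_ : CompactSpace K) (_ : MeasurableSpace K) (_ : BorelSpace K)
      (μ : Measure K), IsProbabilityMeasure μ ∧ K ⊆ N₀ ∧
      (∀ (a u : G) (ψ : G → ℝ), Continuous ψ →
        ∫ k : K, ψ (a * (k * u)) ∂μ = ∫ k : K, ψ (k * (a * u)) ∂μ) ∧
      (∀ (a b x : G) (ψ : G → ℝ), Continuous ψ →
        ∫ k : K, ψ (k * (a * (b * x))) ∂μ = ∫ k : K, ψ (k * ((a * b) * x)) ∂μ) := by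
  have := fl_t2 hl
  let K := flCore N₀
  have hKN : K ⊆ N₀ := fun x hx => hx.1
  have hKc : IsCompact K := by
    have : K = N₀ ∩ ⋂ a : G, (fun n => rdiv (a * n) a) ⁻¹' N₀ := by
      ext n
      simp only [K, flCore, Set.mem_inter_iff, Set.mem_iInter, Set.mem_preimage, Set.mem_setOf_eq]
      refine and_congr_right fun _ => forall_congr' fun a => ?_
      constructor
      · rintro ⟨n', hn', e⟩
        rw [← rdiv_unique a n' _ e.symm]; exact hn'
      · intro h; exact ⟨_, h, (rdiv_mul _ _).symm⟩
    rw [this]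
    refine hcpt.inter_right (isClosed_iInter fun a => hcpt.isClosed.preimage ?_)
    exact hr.comp ((hm.comp (continuous_const.prodMk continuous_id)).prodMk continuous_const)
  letI : Group K :=
    { mul := fun x y => ⟨x.1 * y.1, fl_core_mul N₀ hsub hmulc x.2 y.2⟩
      one := ⟨1, fl_core_one N₀ h1⟩
      inv := fun x => ⟨ldiv x.1 1, fl_core_inv N₀ hsub hinvc x.2⟩
      mul_assoc := fun x y z => Subtype.ext ((hsub (hKN x.2)).1 _ _)
      one_mul := fun x => Subtype.ext (FanLoop.one_mul _)
      mul_one := fun x => Subtype.ext (FanLoop.mul_one _)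
      inv_mul_cancel := fun x => Subtype.ext (fl_inv_mul (hsub (hKN x.2))) }
  have cm : ∀ x y : K, ((x * y : K) : G) = x.1 * y.1 := fun _ _ => rfl
  have c1 : ((1 : K) : G) = 1 := rfl
  haveI : IsTopologicalGroup K :=
    { continuous_mul := by
        refine Continuous.subtype_mk ?_ _
        exact hm.comp ((continuous_subtype_val.comp continuous_fst).prodMk
          (continuous_subtype_val.comp continuous_snd))
      continuous_inv := by
        refine Continuous.subtype_mk ?_ _
        exact hl.comp (continuous_subtype_val.prodMk continuous_const) }
  haveI : CompactSpace K := isCompact_iff_compactSpace.1 hKc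
  letI : MeasurableSpace K := borel K
  haveI : BorelSpace K := ⟨rfl⟩
  obtain ⟨μ, hμ, hC, hR⟩ := haar_mean K
  refine ⟨K, inferInstance, inferInstance, inferInstance, μ, hμ, hKN, ?_, ?_⟩
  · intro a u ψ hψ
    have hex : ∀ a : G, ∀ k : K, ∃ k' : K, a * k.1 = k'.1 * a := fun a k => by
      obtain ⟨n, hn, e⟩ := fl_core_conj N₀ hsub k.2 a
      exact ⟨⟨n, hn⟩, e⟩
    choose c hc using hex
    let C : G → (K →* K) := fun a =>
      { toFun := c a
        map_one' := by
          apply Subtype.ext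
          apply fl_rcancel (a := a)
          rw [← hc, c1, FanLoop.one_mul, FanLoop.mul_one]
        map_mul' := fun x y => by
          apply Subtype.ext
          apply fl_rcancel (a := a)
          rw [← hc, cm, cm, (hsub (hKN (c a x).2)).1, ← hc, ← (hsub (hKN (c a x).2)).1, ← hc,
            (hsub (hKN x.2)).2.1] }
    have hCc : Continuous (C a) := by
      refine continuous_induced_rng.2 ?_
      have : (Subtype.val ∘ (C a)) = fun k : K => rdiv (a * k.1) a := by
        ext k
        exact rdiv_unique _ _ _ (hc a k).symm
      rw [this]
      exact hr.comp ((hm.comp (continuous_const.prodMk continuous_subtype_val)).prodMk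
        continuous_const)
    have hCs : Function.Surjective (C a) := by
      intro k
      refine ⟨c (ldiv a 1) k, Subtype.ext ?_⟩
      change (c a (c (ldiv a 1) k)).1 = k.1
      set k' := c (ldiv a 1) k with hk'
      apply fl_rcancel (a := a * ldiv a 1)
      rw [← (hsub (hKN (c a k').2)).1, ← hc, (hsub (hKN k'.2)).2.1, hk', ← hc,
        ← (hsub (hKN k.2)).2.2, mul_ldiv, FanLoop.one_mul, FanLoop.mul_one]
    have := hC (C a) hCc hCs (fun k => ψ (k.1 * (a * u)))
      (hψ.comp (hm.comp (continuous_subtype_val.prodMk continuous_const)))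
    rw [← this]
    refine integral_congr_ae (Filter.Eventually.of_forall fun k => ?_)
    change ψ _ = ψ ((c a k).1 * (a * u))
    rw [← (hsub (hKN (c a k).2)).1, ← hc, (hsub (hKN k.2)).2.1]
  · intro a b x ψ hψ
    have := hR ⟨t a b x, fl_t_mem N₀ hsub hmulc hinvc ht a b x⟩
      (fun k => ψ (k.1 * (a * (b * x))))
      (hψ.comp (hm.comp (continuous_subtype_val.prodMk continuous_const)))
    rw [← this]
    refine integral_congr_ae (Filter.Eventually.of_forall fun k => ?_)
    simp only [cm]
    rw [t_spec a b x, (hsub (hKN k.2)).1]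

/-- Covering predicate. -/
def flCov (F φ : G → ℝ) (r : ℝ) : Prop :=
  ∃ (ι : Type) (_ : Fintype ι) (b : ι → G) (c : ι → ℝ),
    (∀ j, 0 ≤ c j) ∧ (∀ x : G, F x ≤ ∑ j, c j * φ (b j * x)) ∧ ∑ j, c j ≤ r

theorem flCov.mono {F F' φ : G → ℝ} {r r' : ℝ} (h : flCov F φ r) (hF : ∀ x, F' x ≤ F x)
    (hr : r ≤ r') : flCov F' φ r' := by
  obtain ⟨ι, i, b, c, h0, h1, h2⟩ := h
  exact ⟨ι, i, b, c, h0, fun x => (hF x).trans (h1 x), h2.trans hr⟩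

theorem flCov.comb {φ : G → ℝ} {ι : Type} [Fintype ι] {F : ι → G → ℝ} {r d : ι → ℝ}
    (hd : ∀ i, 0 ≤ d i) (h : ∀ i, flCov (F i) φ (r i)) :
    flCov (fun x => ∑ i, d i * F i x) φ (∑ i, d i * r i) := by
  choose κ fi b c h0 h1 h2 using h
  refine ⟨Σ i, κ i, inferInstance, fun j => b j.1 j.2, fun j => d j.1 * c j.1 j.2,
    fun j => mul_nonneg (hd _) (h0 _ _), fun x => ?_, ?_⟩
  · rw [Fintype.sum_sigma]
    refine Finset.sum_le_sum fun i _ => ?_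
    simp only [mul_assoc]
    rw [← Finset.mul_sum]
    exact mul_le_mul_of_nonneg_left (h1 i x) (hd i)
  · rw [Fintype.sum_sigma]
    refine Finset.sum_le_sum fun i _ => ?_
    simp only
    rw [← Finset.mul_sum]
    exact mul_le_mul_of_nonneg_left (h2 i) (hd i)

theorem flCov.exists_mem {F φ : G → ℝ} {r : ℝ} (h : flCov F φ r) :
    ∃ r' ≤ r, r' ∈ {r : ℝ | ∃ (m : ℕ) (b : Fin m → G) (c : Fin m → ℝ),
    (∀ j, 0 < c j) ∧ (∀ x : G, F x ≤ ∑ j, c j * φ (b j * x)) ∧ r = ∑ j, c j} := by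
  classical
  obtain ⟨ι, i, b, c, h0, h1, h2⟩ := h
  let κ := {j : ι // 0 < c j}
  let e := (Fintype.equivFin κ).symm
  have key : ∀ w : ι → ℝ, ∑ j, c j * w j = ∑ j, c (e j).1 * w (e j).1 := by
    intro w
    rw [Equiv.sum_comp e (fun k : κ => c k.1 * w k.1)]
    rw [← Finset.sum_subtype (Finset.univ.filter fun j => 0 < c j) (by simp) (fun j => c j * w j)]
    symm
    apply Finset.sum_subset (Finset.subset_univ _)
    intro j _ hj
    have : c j = 0 := le_antisymm (by simpa using hj) (h0 j)
    simp [this]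
  refine ⟨∑ j, c (e j).1, ?_, _, fun j => b (e j).1, fun j => c (e j).1, fun j => (e j).2,
    fun x => ?_, rfl⟩
  · have := key (fun _ => 1)
    simp only [_root_.mul_one] at this
    rwa [← this]
  · rw [← key (fun j => φ (b j * x))]; exact h1 x

theorem flCov.bdd (F φ : G → ℝ) : BddBelow {r : ℝ | ∃ (m : ℕ) (b : Fin m → G) (c : Fin m → ℝ),
    (∀ j, 0 < c j) ∧ (∀ x : G, F x ≤ ∑ j, c j * φ (b j * x)) ∧ r = ∑ j, c j} := by
  refine ⟨0, ?_⟩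
  rintro r ⟨m, b, c, h0, -, rfl⟩
  exact Finset.sum_nonneg fun j _ => (h0 j).le

theorem flCov.le {F φ : G → ℝ} {r : ℝ} (h : flCov F φ r) : covRatio F φ ≤ r := by
  obtain ⟨r', h1, h2⟩ := h.exists_mem
  exact (csInf_le (flCov.bdd F φ) h2).trans h1

theorem flCov.approx {F φ : G → ℝ} {r : ℝ} (h : flCov F φ r) {s : ℝ} (hs : covRatio F φ < s) :
    flCov F φ s := by
  obtain ⟨r', -, h2⟩ := h.exists_mem
  obtain ⟨q, ⟨m, b, c, h0, h1, rfl⟩, hq⟩ := exists_lt_of_csInf_lt ⟨r', h2⟩ hs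
  exact ⟨Fin m, inferInstance, b, c, fun j => (h0 j).le, h1, hq.le⟩

theorem flCov_of_compact [TopologicalSpace G]
    (hm : Continuous fun q : G × G => q.1 * q.2) {φ : G → ℝ} (hφ : Continuous φ)
    (hφ0 : ∀ x, 0 ≤ φ x) (hφne : φ ≠ 0) {S : Set G} (hS : IsCompact S) :
    ∃ r, 0 ≤ r ∧ flCov (S.indicator 1) φ r := by
  classical
  obtain ⟨y, hy⟩ := Function.ne_iff.1 hφne
  have hy : 0 < φ y := lt_of_le_of_ne (hφ0 y) (Ne.symm hy)
  obtain ⟨T, hT⟩ := hS.elim_finite_subcover (fun g : G => {x | φ y / 2 < φ (rdiv y g * x)})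
    (fun g => isOpen_lt continuous_const
      (hφ.comp (hm.comp (continuous_const.prodMk continuous_id))))
    (fun x _ => Set.mem_iUnion.2 ⟨x, by
      simp only [Set.mem_setOf_eq, rdiv_mul]; linarith⟩)
  let e := T.equivFin.symm
  have hc : 0 ≤ 2 / φ y := by positivity
  refine ⟨∑ j : Fin T.card, 2 / φ y, Finset.sum_nonneg fun _ _ => hc, Fin T.card, inferInstance,
    fun j => rdiv y (e j).1, fun _ => 2 / φ y, fun _ => hc, fun x => ?_, le_rfl⟩
  by_cases hx : x ∈ S
  · rw [Set.indicator_of_mem hx]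
    obtain ⟨g, hg, hgx⟩ := Set.mem_iUnion₂.1 (hT hx)
    have h1 : (1 : ℝ) ≤ 2 / φ y * φ (rdiv y g * x) := by
      simp only [Set.mem_setOf_eq] at hgx
      rw [div_mul_eq_mul_div, le_div_iff₀ hy]; linarith
    have h2 := Finset.single_le_sum (f := fun j => 2 / φ y * φ (rdiv y (e j).1 * x))
      (fun j _ => mul_nonneg hc (hφ0 _)) (Finset.mem_univ (e.symm ⟨g, hg⟩))
    simp only [Equiv.apply_symm_apply] at h2
    exact h1.trans h2
  · rw [Set.indicator_of_notMem hx]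
    exact Finset.sum_nonneg fun j _ => mul_nonneg hc (hφ0 _)

theorem flCov_exists [TopologicalSpace G]
    (hm : Continuous fun q : G × G => q.1 * q.2) {F φ : G → ℝ} (hF : Continuous F)
    (hFs : HasCompactSupport F) (hφ : Continuous φ)
    (hφ0 : ∀ x, 0 ≤ φ x) (hφne : φ ≠ 0) : ∃ r, flCov F φ r := by
  obtain ⟨r, -, hr⟩ := flCov_of_compact hm hφ hφ0 hφne hFs
  obtain ⟨M, hM⟩ := hFs.exists_bound_of_continuous hF
  have := flCov.comb (ι := Unit) (d := fun _ => M) (F := fun _ => (tsupport F).indicator 1)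
    (r := fun _ => r) (fun _ => (norm_nonneg _).trans (hM 1)) (fun _ => hr)
  refine ⟨_, this.mono (fun x => ?_) le_rfl⟩
  simp only [Finset.univ_unique, Finset.sum_singleton]
  by_cases hx : x ∈ tsupport F
  · rw [Set.indicator_of_mem hx]
    simpa using (le_abs_self _).trans (hM x)
  · rw [Set.indicator_of_notMem hx, image_eq_zero_of_notMem_tsupport hx]; simp

theorem covRatio_pos' [TopologicalSpace G]
    (hm : Continuous fun q : G × G => q.1 * q.2) {F φ : G → ℝ} (hF : Continuous F)
    (hFs : HasCompactSupport F) (hF0 : ∀ x, 0 ≤ F x) (hFne : F ≠ 0) (hφ : Continuous φ)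
    (hφs : HasCompactSupport φ)
    (hφ0 : ∀ x, 0 ≤ φ x) (hφne : φ ≠ 0) : 0 < covRatio F φ := by
  obtain ⟨y, hy⟩ := Function.ne_iff.1 hFne
  have hy : 0 < F y := lt_of_le_of_ne (hF0 y) (Ne.symm hy)
  obtain ⟨M, hM⟩ := hφs.exists_bound_of_continuous hφ
  obtain ⟨z, hz⟩ := Function.ne_iff.1 hφne
  have hz : 0 < φ z := lt_of_le_of_ne (hφ0 z) (Ne.symm hz)
  have hM' : ∀ x, φ x ≤ M := fun x => (le_abs_self _).trans (hM x)
  have hMp : 0 < M := hz.trans_le (hM' z)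
  obtain ⟨r, hr⟩ := flCov_exists hm hF hFs hφ hφ0 hφne
  obtain ⟨r', -, h2⟩ := hr.exists_mem
  refine (div_pos hy hMp).trans_le (le_csInf ⟨r', h2⟩ ?_)
  rintro _ ⟨m, b, c, h0, h1, rfl⟩
  rw [div_le_iff₀ hMp, Finset.sum_mul]
  exact (h1 y).trans (Finset.sum_le_sum fun j _ => mul_le_mul_of_nonneg_left (hM' _) (h0 j).le)

theorem riemann_approx {K S : Type*} [TopologicalSpace K] [CompactSpace K] [MeasurableSpace K]
    [BorelSpace K] (μ : Measure K) [IsProbabilityMeasure μ] [TopologicalSpace S] [CompactSpace S]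
    (F : K × S → ℝ) (hF : Continuous F) {δ : ℝ} (hδ : 0 < δ) :
    ∃ (ι : Type) (_ : Fintype ι) (w : ι → ℝ) (k : ι → K), (∀ i, 0 ≤ w i) ∧ ∑ i, w i = 1 ∧
      ∀ x, ∫ k, F (k, x) ∂μ ≤ ∑ i, w i * F (k i, x) + δ := by
  let f : C(K, C(S, ℝ)) := ContinuousMap.curry ⟨F, hF⟩
  have hint : Integrable f μ := f.continuous.integrable_of_hasCompactSupport
    (HasCompactSupport.of_compactSpace _)
  have hmem : ∫ k, f k ∂μ ∈ closure (convexHull ℝ (Set.range f)) :=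
    (convex_convexHull ℝ _).closure.integral_mem isClosed_closure
      (Filter.Eventually.of_forall fun k => subset_closure (subset_convexHull ℝ _ ⟨k, rfl⟩)) hint
  obtain ⟨g, hg, hd⟩ := Metric.mem_closure_iff.1 hmem δ hδ
  obtain ⟨ι, fi, w, z, h0, h1, hz, rfl⟩ := mem_convexHull_iff_exists_fintype.1 hg
  choose k hk using hz
  refine ⟨ι, fi, w, k, h0, h1, fun x => ?_⟩
  have e1 : (∫ k, f k ∂μ) x = ∫ k, F (k, x) ∂μ := by
    have := (ContinuousMap.evalCLM ℝ x : C(S, ℝ) →L[ℝ] ℝ).integral_comp_comm hint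
    exact this.symm
  have e2 : (∑ i, w i • z i) x = ∑ i, w i * F (k i, x) := by
    rw [ContinuousMap.sum_apply]
    refine Finset.sum_congr rfl fun i _ => ?_
    rw [← hk i]; rfl
  have := (ContinuousMap.dist_apply_le_dist x).trans_lt hd
  rw [e1, e2, Real.dist_eq] at this
  linarith [(abs_lt.1 this).2]

theorem flCov_mean [TopologicalSpace G]
    (hm : Continuous fun q : G × G => q.1 * q.2)
    (hl : Continuous fun q : G × G => ldiv q.1 q.2)
    {φ : G → ℝ} (hφ : Continuous φ) (hφs : HasCompactSupport φ)
    (hφ0 : ∀ x, 0 ≤ φ x) (hφne : φ ≠ 0)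
    (K : Set G) [CompactSpace K] [MeasurableSpace K] [BorelSpace K]
    (μ : Measure K) [IsProbabilityMeasure μ] (hK : K ⊆ nucleus G) (e : G) {ε : ℝ} (hε : 0 < ε) :
    flCov (fun x => ∫ k : K, φ (k * (e * x)) ∂μ) φ (1 + ε) := by
  let S : Set G := (fun q : G × G => ldiv e (ldiv q.1 q.2)) '' (K ×ˢ tsupport φ)
  have hS : IsCompact S := ((isCompact_iff_compactSpace.2 inferInstance).prod hφs).image
    (hl.comp (continuous_const.prodMk hl))
  haveI : CompactSpace S := isCompact_iff_compactSpace.1 hS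
  obtain ⟨r, hr0, hr⟩ := flCov_of_compact hm hφ hφ0 hφne hS
  obtain ⟨ι, fi, w, k, hw0, hw1, hw⟩ := riemann_approx μ
    (fun q : K × S => φ (q.1.1 * (e * q.2.1)))
    (hφ.comp (hm.comp ((continuous_subtype_val.comp continuous_fst).prodMk
      (hm.comp (continuous_const.prodMk (continuous_subtype_val.comp continuous_snd))))))
    (δ := ε / (r + 1)) (by positivity)
  obtain ⟨κ, fκ, b, c, hc0, hc1, hc2⟩ := hr
  have hδ : 0 ≤ ε / (r + 1) := by positivity
  refine ⟨ι ⊕ κ, inferInstance, Sum.elim (fun i => (k i).1 * e) b,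
    Sum.elim w (fun j => ε / (r + 1) * c j), ?_, fun x => ?_, ?_⟩
  · rintro (i | j)
    · exact hw0 i
    · exact mul_nonneg hδ (hc0 j)
  · simp only [Fintype.sum_sum_type, Sum.elim_inl, Sum.elim_inr]
    have hk : ∀ i, (k i).1 * e * x = (k i).1 * (e * x) := fun i => (hK (k i).2).1 _ _
    simp only [hk, mul_assoc, ← Finset.mul_sum]
    have h2 := hc1 x
    by_cases hx : x ∈ S
    · rw [Set.indicator_of_mem hx] at h2
      refine (hw ⟨x, hx⟩).trans (add_le_add le_rfl ?_)
      exact le_mul_of_one_le_right hδ h2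
    · rw [Set.indicator_of_notMem hx] at h2
      have : ∀ k : K, φ (k * (e * x)) = 0 := by
        intro k
        by_contra hne
        refine hx ⟨(k.1, k.1 * (e * x)), ⟨k.2, subset_tsupport _ hne⟩, ?_⟩
        simp only
        rw [← ldiv_unique k.1 (e * x) _ rfl, ← ldiv_unique e x _ rfl]
      simp only [this, integral_zero]
      exact add_nonneg (by simp)
        (mul_nonneg hδ h2)
  · simp only [Fintype.sum_sum_type, Sum.elim_inl, Sum.elim_inr, ← Finset.mul_sum, hw1]
    refine add_le_add le_rfl ?_
    calc ε / (r + 1) * ∑ j, c j ≤ ε / (r + 1) * (r + 1) :=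
          mul_le_mul_of_nonneg_left (by linarith) hδ
      _ = ε := by field_simp

/-- Submultiplicativity from a pointwise mean bound. -/
theorem fl_submul {F g φ : G → ℝ} (M : G → G → ℝ)
    (hM : ∀ e, ∀ ε > 0, flCov (M e) φ (1 + ε))
    (h1 : ∃ r, flCov F g r) (h2 : ∃ r, flCov g φ r)
    (hp1 : 0 < covRatio F g) (hp2 : 0 < covRatio g φ)
    (H : ∀ (ι κ : Type) (_ : Fintype ι) (_ : Fintype κ) (b : ι → G) (c : ι → ℝ) (a : κ → G)
      (d : κ → ℝ), (∀ j, 0 ≤ c j) → (∀ x, F x ≤ ∑ j, c j * g (b j * x)) → (∀ j, 0 ≤ d j) →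
      (∀ x, g x ≤ ∑ j, d j * φ (a j * x)) →
      ∀ x, F x ≤ ∑ j, c j * ∑ l, d l * M (a l * b j) x) :
    covRatio F φ ≤ covRatio F g * covRatio g φ := by
  obtain ⟨r1, h1⟩ := h1
  obtain ⟨r2, h2⟩ := h2
  have key : ∀ ε > 0, covRatio F φ ≤
      (covRatio F g + ε) * ((covRatio g φ + ε) * (1 + ε)) := by
    intro ε hε
    obtain ⟨ι, i1, b, c, hc0, hc1, hc2⟩ := h1.approx (lt_add_of_pos_right _ hε)
    obtain ⟨κ, i2, a, d, hd0, hd1, hd2⟩ := h2.approx (lt_add_of_pos_right _ hε)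
    have hx := H ι κ i1 i2 b c a d hc0 hc1 hd0 hd1
    have := flCov.comb hc0 (fun j => flCov.comb hd0 (fun l => hM (a l * b j) ε hε))
    refine (this.mono hx ?_).le
    rw [← Finset.sum_mul, ← Finset.sum_mul]
    have : 0 ≤ ∑ j, d j := Finset.sum_nonneg fun j _ => hd0 j
    gcongr
  have hlim : Filter.Tendsto (fun ε : ℝ => (covRatio F g + ε) * ((covRatio g φ + ε) * (1 + ε)))
      (nhdsWithin 0 (Set.Ioi 0)) (nhds (covRatio F g * covRatio g φ)) := by
    have : Continuous (fun ε : ℝ => (covRatio F g + ε) * ((covRatio g φ + ε) * (1 + ε))) := by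
      fun_prop
    have h := (this.tendsto 0).mono_left (nhdsWithin_le_nhds (s := Set.Ioi 0))
    simpa using h
  exact ge_of_tendsto hlim (Filter.eventually_of_mem self_mem_nhdsWithin key)

end CovAux

/-- Theorem 3.9 of Ludkowski: two-sided bounds for the normalized functional
J_{φ,f₀}(f) = (f : φ)/(f₀ : φ). -/
theorem covRatio_bounds {G : Type*} [TopologicalSpace G] [T1Space G]
    [LocallyCompactSpace G] [FanLoop G]
    (hm : Continuous fun q : G × G => q.1 * q.2)
    (hl : Continuous fun q : G × G => ldiv q.1 q.2)
    (hr : Continuous fun q : G × G => rdiv q.1 q.2)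
    -- Condition (3.5.2): a compact subgroup N₀ of the nucleus containing all t, p values
    (N₀ : Set G) (hcpt : IsCompact N₀) (hsub : N₀ ⊆ nucleus G) (h1 : (1 : G) ∈ N₀)
    (hmulc : ∀ x ∈ N₀, ∀ y ∈ N₀, x * y ∈ N₀) (hinvc : ∀ x ∈ N₀, ldiv x 1 ∈ N₀)
    (ht : ∀ a b c : G, t a b c ∈ N₀) (hp : ∀ a b c : G, p a b c ∈ N₀)
    (f f₁ φ f₀ : G → ℝ)
    (hf : Continuous f) (hfs : HasCompactSupport f) (hf0 : ∀ x : G, 0 ≤ f x) (hfne : f ≠ 0)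
    (hf₁ : Continuous f₁) (hf₁s : HasCompactSupport f₁) (hf₁0 : ∀ x : G, 0 ≤ f₁ x)
    (hf₁ne : f₁ ≠ 0)
    (hφ : Continuous φ) (hφs : HasCompactSupport φ) (hφ0 : ∀ x : G, 0 ≤ φ x) (hφne : φ ≠ 0)
    -- f₀ ∈ Υ(G, N₀)
    (hf₀ : Continuous f₀) (hf₀s : HasCompactSupport f₀) (hf₀0 : ∀ x : G, 0 ≤ f₀ x)
    (hf₀ne : f₀ ≠ 0) (hf₀inv : ∀ a : G, ∀ γ ∈ N₀, f₀ (γ * a) = f₀ a) :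
    ((covRatio f₀ f)⁻¹ ≤ covRatio f φ / covRatio f₀ φ ∧
      covRatio f φ / covRatio f₀ φ ≤ covRatio f f₀) ∧
    ((covRatio f₁ f₀)⁻¹ * (covRatio f₀ f)⁻¹ ≤ covRatio f φ / covRatio f₁ φ ∧
      covRatio f φ / covRatio f₁ φ ≤ covRatio f f₀ * covRatio f₀ f₁) := by
  have := fl_t2 hl
  obtain ⟨K, iK, iM, iB, μ, iP, hKN, inv1, inv3⟩ :=
    fl_mean hm hl hr N₀ hcpt hsub h1 hmulc hinvc ht
  have hKn : K ⊆ nucleus G := hKN.trans hsub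
  have hint : ∀ ψ : G → ℝ, Continuous ψ → ∀ a b u : G,
      MeasureTheory.Integrable (fun k : K => ψ (a * (b * (k * u)))) μ := by
    intro ψ hψ a b u
    have hc : Continuous (fun k : K => ψ (a * (b * (k * u)))) :=
      hψ.comp (hm.comp (continuous_const.prodMk (hm.comp (continuous_const.prodMk
        (hm.comp (continuous_subtype_val.prodMk continuous_const))))))
    exact hc.integrable_of_hasCompactSupport (HasCompactSupport.of_compactSpace _)
  have hint' : ∀ ψ : G → ℝ, Continuous ψ → ∀ a u : G,
      MeasureTheory.Integrable (fun k : K => ψ (a * (k * u))) μ := by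
    intro ψ hψ a u
    have := hint ψ hψ 1 a u
    simpa only [FanLoop.one_mul] using this
  have hf₀c : ∀ u, f₀ u = ∫ k : K, f₀ (k * u) ∂μ := by
    intro u
    have : ∀ k : K, f₀ (k * u) = f₀ u := fun k => hf₀inv u k (hKN k.2)
    simp [this]
  let M : G → G → ℝ := fun e x => ∫ k : K, φ (k * (e * x)) ∂μ
  have hM : ∀ e, ∀ ε > 0, flCov (M e) φ (1 + ε) := fun e ε hε =>
    flCov_mean hm hl hφ hφs hφ0 hφne K μ hKn e hε
  -- first inequality
  have A : ∀ g : G → ℝ, Continuous g → HasCompactSupport g → (∀ x, 0 ≤ g x) → g ≠ 0 →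
      covRatio g φ ≤ covRatio g f₀ * covRatio f₀ φ := by
    intro g hg hgs hg0 hgne
    refine fl_submul M hM (flCov_exists hm hg hgs hf₀ hf₀0 hf₀ne)
      (flCov_exists hm hf₀ hf₀s hφ hφ0 hφne) (covRatio_pos' hm hg hgs hg0 hgne hf₀ hf₀s hf₀0 hf₀ne)
      (covRatio_pos' hm hf₀ hf₀s hf₀0 hf₀ne hφ hφs hφ0 hφne) ?_
    intro ι κ i1 i2 b c a d hc0 hc1 hd0 hd1 x
    refine (hc1 x).trans (Finset.sum_le_sum fun j _ => mul_le_mul_of_nonneg_left ?_ (hc0 j))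
    have hi : ∀ l, MeasureTheory.Integrable (fun k : K => d l * φ (a l * (k * (b j * x)))) μ :=
      fun l => (hint' φ hφ _ _).const_mul _
    calc f₀ (b j * x) = ∫ k : K, f₀ (k * (b j * x)) ∂μ := hf₀c _
      _ ≤ ∫ k : K, ∑ l, d l * φ (a l * (k * (b j * x))) ∂μ := by
          refine MeasureTheory.integral_mono ?_ (MeasureTheory.integrable_finsetSum _ fun l _ => hi l)
            (fun k => hd1 _)
          have := hint' f₀ hf₀ 1 (b j * x)
          simpa only [FanLoop.one_mul] using this
      _ = ∑ l, d l * ∫ k : K, φ (a l * (k * (b j * x))) ∂μ := by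
          rw [MeasureTheory.integral_finsetSum _ fun l _ => hi l]
          simp only [MeasureTheory.integral_const_mul]
      _ = ∑ l, d l * M (a l * b j) x := by
          refine Finset.sum_congr rfl fun l _ => ?_
          rw [inv1 _ _ φ hφ, inv3 _ _ _ φ hφ]
  have B : ∀ g : G → ℝ, Continuous g → HasCompactSupport g → (∀ x, 0 ≤ g x) → g ≠ 0 →
      covRatio f₀ φ ≤ covRatio f₀ g * covRatio g φ := by
    intro g hg hgs hg0 hgne
    refine fl_submul M hM (flCov_exists hm hf₀ hf₀s hg hg0 hgne)
      (flCov_exists hm hg hgs hφ hφ0 hφne) (covRatio_pos' hm hf₀ hf₀s hf₀0 hf₀ne hg hgs hg0 hgne)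
      (covRatio_pos' hm hg hgs hg0 hgne hφ hφs hφ0 hφne) ?_
    intro ι κ i1 i2 b c a d hc0 hc1 hd0 hd1 x
    have hi : ∀ j l, MeasureTheory.Integrable
        (fun k : K => d l * φ (a l * (b j * (k * x)))) μ :=
      fun j l => (hint φ hφ _ _ _).const_mul _
    have hi2 : ∀ j, MeasureTheory.Integrable
        (fun k : K => c j * ∑ l, d l * φ (a l * (b j * (k * x)))) μ :=
      fun j => (MeasureTheory.integrable_finsetSum _ fun l _ => hi j l).const_mul _
    calc f₀ x = ∫ k : K, f₀ (k * x) ∂μ := hf₀c _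
      _ ≤ ∫ k : K, ∑ j, c j * ∑ l, d l * φ (a l * (b j * (k * x))) ∂μ := by
          refine MeasureTheory.integral_mono ?_ (MeasureTheory.integrable_finsetSum _ fun j _ => hi2 j)
            (fun k => ?_)
          · have := hint' f₀ hf₀ 1 x
            simpa only [FanLoop.one_mul] using this
          · exact (hc1 _).trans (Finset.sum_le_sum fun j _ =>
              mul_le_mul_of_nonneg_left (hd1 _) (hc0 j))
      _ = ∑ j, c j * ∑ l, d l * ∫ k : K, φ (a l * (b j * (k * x))) ∂μ := by
          rw [MeasureTheory.integral_finsetSum _ fun j _ => hi2 j]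
          refine Finset.sum_congr rfl fun j _ => ?_
          rw [MeasureTheory.integral_const_mul, MeasureTheory.integral_finsetSum _ fun l _ => hi j l]
          simp only [MeasureTheory.integral_const_mul]
      _ = ∑ j, c j * ∑ l, d l * M (a l * b j) x := by
          refine Finset.sum_congr rfl fun j _ => ?_
          congr 1
          refine Finset.sum_congr rfl fun l _ => ?_
          rw [inv1 (b j) x (fun y => φ (a l * y))
            (hφ.comp (hm.comp (continuous_const.prodMk continuous_id))),
            inv1 _ _ φ hφ, inv3 _ _ _ φ hφ]
  have p1 := covRatio_pos' hm hf₀ hf₀s hf₀0 hf₀ne hf hfs hf0 hfne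
  have p2 := covRatio_pos' hm hf₀ hf₀s hf₀0 hf₀ne hφ hφs hφ0 hφne
  have p3 := covRatio_pos' hm hf₁ hf₁s hf₁0 hf₁ne hφ hφs hφ0 hφne
  have p4 := covRatio_pos' hm hf₁ hf₁s hf₁0 hf₁ne hf₀ hf₀s hf₀0 hf₀ne
  have p5 := covRatio_pos' hm hf hfs hf0 hfne hf₀ hf₀s hf₀0 hf₀ne
  have Af := A f hf hfs hf0 hfne
  have Af1 := A f₁ hf₁ hf₁s hf₁0 hf₁ne
  have Bf := B f hf hfs hf0 hfne
  have Bf1 := B f₁ hf₁ hf₁s hf₁0 hf₁ne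
  refine ⟨⟨?_, ?_⟩, ?_, ?_⟩
  · rw [le_div_iff₀ p2, inv_mul_le_iff₀ p1]; exact Bf
  · rw [div_le_iff₀ p2]; exact Af
  · rw [le_div_iff₀ p3, ← mul_inv, inv_mul_le_iff₀ (mul_pos p4 p1), mul_assoc]
    exact Af1.trans (mul_le_mul_of_nonneg_left Bf p4.le)
  · rw [div_le_iff₀ p3, mul_assoc]
    exact Af.trans (mul_le_mul_of_nonneg_left Bf1 p5.le)
end
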